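/- arXiv:1502.07302 — 3 statements merged into one kernel-verified Lean document; each statement's English description precedes it below -/
import Mathlib

section
/- Let D ⊆ ℂ be the open unit disc, ε ∈ (0,1), and β ∈ [0,2). Then there is a constant C = C(ε,β) such that for every z ∈ D, ∫_D (1 − |w|²)^{−ε} |1 − z·conj(w)|^{−2} |w|^{−β} dV(w) ≤ C (1 − |z|²)^{−ε}. -/
open MeasureTheory Set NNReal ENNReal ComplexConjugate

noncomputable section

/-- The mean value of the Poisson kernel over a circle. -/
theorem circleAverage_inv_norm_one_sub_mul_sq {c : ℂ} (hc : ‖c‖ < 1) :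
    Real.circleAverage (fun w ↦ (‖1 - c * w‖ ^ 2)⁻¹) 0 1 = (1 - ‖c‖ ^ 2)⁻¹ := by
  have hne : ∀ w ∈ Metric.closedBall (0 : ℂ) 1, 1 - c * w ≠ 0 := by
    intro w hw h
    rw [mem_closedBall_zero_iff] at hw
    have h1 : ‖c * w‖ = 1 := by rw [← sub_eq_zero.mp h, norm_one]
    rw [norm_mul] at h1
    nlinarith [norm_nonneg c, norm_nonneg w]
  have hd : DiffContOnCl ℂ (fun w ↦ (1 + c * w) / (1 - c * w)) (Metric.ball 0 |1|) := by
    rw [abs_one]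
    refine DifferentiableOn.diffContOnCl ?_
    rw [closure_ball _ one_ne_zero]
    exact DifferentiableOn.div (by fun_prop) (by fun_prop) hne
  have hmean := hd.circleAverage
  have hci : CircleIntegrable (fun w ↦ (1 + c * w) / (1 - c * w)) 0 1 := by
    refine ContinuousOn.circleIntegrable zero_le_one ?_
    exact ContinuousOn.div (by fun_prop) (by fun_prop)
      fun w hw ↦ hne w (Metric.sphere_subset_closedBall hw)
  have hre := Complex.reCLM.circleAverage_comp_comm hci
  rw [hmean] at hre
  have hcongr : Real.circleAverage (fun w ↦ (‖1 - c * w‖ ^ 2)⁻¹) 0 1 =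
      Real.circleAverage ((1 - ‖c‖ ^ 2)⁻¹ • (Complex.reCLM ∘ fun w ↦ (1 + c * w) / (1 - c * w)))
        0 1 := by
    refine Real.circleAverage_congr_sphere fun w hw ↦ ?_
    rw [abs_one] at hw
    have h0 := hne w (Metric.sphere_subset_closedBall hw)
    have hw1 : ‖c * w‖ ^ 2 = ‖c‖ ^ 2 := by rw [norm_mul, mem_sphere_zero_iff_norm.mp hw, mul_one]
    have hpos : 0 < 1 - ‖c‖ ^ 2 := by nlinarith [norm_nonneg c]
    have h2 : Complex.normSq (1 - c * w) ≠ 0 := by simpa using h0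
    simp only [Pi.smul_apply, Function.comp_apply, Complex.reCLM_apply, smul_eq_mul, ← hw1]
      at hpos ⊢
    generalize c * w = u at *
    rw [Complex.div_re, Complex.sq_norm, Complex.sq_norm] at *
    field_simp
    simp only [Complex.normSq_apply, Complex.add_re, Complex.sub_re, Complex.add_im,
      Complex.sub_im, Complex.one_re, Complex.one_im]
    ring
  rw [hcongr, Real.circleAverage_smul, hre]
  simp

theorem lintegral_inv_norm_one_sub_mul_exp_sq {c : ℂ} (hc : ‖c‖ < 1) :
    ∫⁻ θ in Ioo (-Real.pi) Real.pi,
        ENNReal.ofReal (‖1 - c * Complex.exp (θ * Complex.I)‖ ^ 2)⁻¹ =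
      ENNReal.ofReal (2 * Real.pi * (1 - ‖c‖ ^ 2)⁻¹) := by
  have hne : ∀ θ : ℝ, ‖1 - c * Complex.exp (θ * Complex.I)‖ ^ 2 ≠ 0 := by
    intro θ h
    have h1 : ‖c * Complex.exp (θ * Complex.I)‖ = 1 := by
      rw [← sub_eq_zero.mp (norm_eq_zero.mp (pow_eq_zero_iff two_ne_zero |>.mp h)), norm_one]
    rw [norm_mul, Complex.norm_exp_ofReal_mul_I] at h1
    linarith
  have hcont : Continuous fun θ : ℝ ↦ (‖1 - c * Complex.exp (θ * Complex.I)‖ ^ 2)⁻¹ :=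
    Continuous.inv₀ (by fun_prop) hne
  have hle : -Real.pi ≤ Real.pi := by linarith [Real.pi_pos]
  rw [setLIntegral_congr Ioo_ae_eq_Ioc,
    ← ofReal_integral_eq_lintegral_ofReal
      ((intervalIntegrable_iff_integrableOn_Ioc_of_le hle).mp (hcont.intervalIntegrable _ _))
      (Filter.Eventually.of_forall fun θ ↦ by positivity),
    ← intervalIntegral.integral_of_le hle, ← circleAverage_inv_norm_one_sub_mul_sq hc,
    Real.circleAverage_eq_integral_add (-Real.pi),
    intervalIntegral.integral_comp_add_right
      (fun θ ↦ (‖1 - c * circleMap 0 1 θ‖ ^ 2)⁻¹) (-Real.pi)]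
  congr 1
  have h2 : 2 * Real.pi + -Real.pi = Real.pi := by ring
  have hpi := Real.pi_ne_zero
  simp only [h2, zero_add, circleMap, Complex.ofReal_one, one_mul, smul_eq_mul]
  rw [mul_inv_cancel_left₀ (mul_ne_zero two_ne_zero hpi)]

theorem lintegral_Ioo_zero_rpow {p t : ℝ} (hp : -1 < p) (ht : 0 ≤ t) :
    ∫⁻ s in Ioo 0 t, ENNReal.ofReal (s ^ p) = ENNReal.ofReal (t ^ (p + 1) / (p + 1)) := by
  rw [setLIntegral_congr Ioo_ae_eq_Ioc,
    ← ofReal_integral_eq_lintegral_ofReal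
      ((intervalIntegrable_iff_integrableOn_Ioc_of_le ht).mp
        (intervalIntegral.intervalIntegrable_rpow' hp)),
    ← intervalIntegral.integral_of_le ht, integral_rpow (Or.inl hp),
    Real.zero_rpow (by linarith), sub_zero]
  filter_upwards [ae_restrict_mem measurableSet_Ioc] with s hs
  exact Real.rpow_nonneg hs.1.le _

theorem lintegral_Ioi_rpow {p t : ℝ} (hp : p < -1) (ht : 0 < t) :
    ∫⁻ s in Ioi t, ENNReal.ofReal (s ^ p) = ENNReal.ofReal (-t ^ (p + 1) / (p + 1)) := by
  rw [← ofReal_integral_eq_lintegral_ofReal (integrableOn_Ioi_rpow_of_lt hp ht),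
    integral_Ioi_rpow_of_lt hp ht]
  filter_upwards [ae_restrict_mem measurableSet_Ioi] with s hs
  exact Real.rpow_nonneg (ht.trans hs).le _

theorem lintegral_rpow_div_max_le {ε δ : ℝ} (hε : ε ∈ Ioo (0 : ℝ) 1) (hδ : 0 < δ) :
    ∫⁻ s in Ioi 0, ENNReal.ofReal (s ^ (-ε) / max s δ) ≤
      ENNReal.ofReal ((1 / (1 - ε) + 1 / ε) * δ ^ (-ε)) := by
  obtain ⟨h0, h1⟩ := hε
  have h1' : 0 < 1 - ε := by linarith
  rw [← Ioc_union_Ioi_eq_Ioi hδ.le]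
  refine (lintegral_union_le _ _ _).trans ?_
  have hsmall : ∫⁻ s in Ioc 0 δ, ENNReal.ofReal (s ^ (-ε) / max s δ) ≤
      ENNReal.ofReal (1 / (1 - ε) * δ ^ (-ε)) := by
    calc _ ≤ ∫⁻ s in Ioc 0 δ, ENNReal.ofReal δ⁻¹ * ENNReal.ofReal (s ^ (-ε)) := by
          refine setLIntegral_mono' measurableSet_Ioc fun s hs ↦ ?_
          rw [← ENNReal.ofReal_mul (by positivity), max_eq_right hs.2, div_eq_inv_mul]
      _ = ENNReal.ofReal (1 / (1 - ε) * δ ^ (-ε)) := by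
          rw [lintegral_const_mul' _ _ ENNReal.ofReal_ne_top, ← setLIntegral_congr Ioo_ae_eq_Ioc,
            lintegral_Ioo_zero_rpow (by linarith) hδ.le, ← ENNReal.ofReal_mul (by positivity),
            Real.rpow_add_one hδ.ne', neg_add_eq_sub]
          congr 1
          field_simp
  have hlarge : ∫⁻ s in Ioi δ, ENNReal.ofReal (s ^ (-ε) / max s δ) ≤
      ENNReal.ofReal (1 / ε * δ ^ (-ε)) := by
    calc _ ≤ ∫⁻ s in Ioi δ, ENNReal.ofReal (s ^ (-ε - 1)) := by
          refine setLIntegral_mono' measurableSet_Ioi fun s hs ↦ ?_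
          rw [max_eq_left (le_of_lt hs), Real.rpow_sub_one (hδ.trans hs).ne']
      _ = ENNReal.ofReal (1 / ε * δ ^ (-ε)) := by
          rw [lintegral_Ioi_rpow (by linarith) hδ]
          congr 1
          rw [sub_add_cancel]
          field_simp
  rw [add_mul, ENNReal.ofReal_add (by positivity) (by positivity)]
  exact add_le_add hsmall hlarge

theorem radial_weight_le {ε β a r : ℝ} (hε : ε ∈ Ioo (0 : ℝ) 1) (hβ : β ∈ Ico (0 : ℝ) 2)
    (ha : a ∈ Ico (0 : ℝ) 1) (hr : r ∈ Ioo (0 : ℝ) 1) :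
    r * ((1 - r ^ 2) ^ (-ε) * r ^ (-β)) * (1 - (a * r) ^ 2)⁻¹ ≤
      4 * r ^ (1 - β) + 2 * ((1 - r) ^ (-ε) / max (1 - r) ((1 - a ^ 2) / 2)) := by
  obtain ⟨hε0, hε1⟩ := hε
  obtain ⟨hβ0, hβ2⟩ := hβ
  obtain ⟨ha0, ha1⟩ := ha
  obtain ⟨hr0, hr1⟩ := hr
  have h1r : 0 < 1 - r := by linarith
  have hδ : 0 < max (1 - r) ((1 - a ^ 2) / 2) := lt_max_of_lt_left h1r
  have har : a * r ≤ r := by nlinarith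
  have har' : a * r ≤ a := by nlinarith
  have har0 : 0 ≤ a * r := by positivity
  have hden : max (1 - r) ((1 - a ^ 2) / 2) ≤ 1 - (a * r) ^ 2 :=
    max_le (by nlinarith) (by nlinarith)
  have hdenpos := hδ.trans_le hden
  have hw : (1 - r ^ 2) ^ (-ε) ≤ (1 - r) ^ (-ε) :=
    Real.rpow_le_rpow_of_nonpos h1r (by nlinarith) (by linarith)
  have hwpos : 0 ≤ (1 - r) ^ (-ε) := by positivity
  have hpow : r * ((1 - r ^ 2) ^ (-ε) * r ^ (-β)) = (1 - r ^ 2) ^ (-ε) * r ^ (1 - β) := by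
    rw [sub_eq_add_neg 1 β, Real.rpow_add hr0, Real.rpow_one]
    ring
  have hp : 0 ≤ r ^ (1 - β) := by positivity
  rw [hpow]
  rcases le_total r (1 / 2) with h | h
  · have h2 : (1 - r) ^ (-ε) ≤ 2 := by
      calc (1 - r) ^ (-ε) ≤ (1 - r) ^ (-1 : ℝ) :=
            Real.rpow_le_rpow_of_exponent_ge h1r (by linarith) (by linarith)
        _ = (1 - r)⁻¹ := Real.rpow_neg_one _
        _ ≤ 2 := by rw [inv_le_comm₀ h1r two_pos]; linarith
    have h3 : (1 - (a * r) ^ 2)⁻¹ ≤ 2 := by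
      rw [inv_le_comm₀ hdenpos two_pos]; nlinarith
    have h4 : (1 - r ^ 2) ^ (-ε) * r ^ (1 - β) * (1 - (a * r) ^ 2)⁻¹ ≤ 2 * r ^ (1 - β) * 2 := by
      gcongr
      exact hw.trans h2
    have : 0 ≤ (1 - r) ^ (-ε) / max (1 - r) ((1 - a ^ 2) / 2) := by positivity
    linarith
  · have h2 : r ^ (1 - β) ≤ 2 := by
      calc r ^ (1 - β) ≤ r ^ (-1 : ℝ) :=
            Real.rpow_le_rpow_of_exponent_ge hr0 hr1.le (by linarith)
        _ = r⁻¹ := Real.rpow_neg_one _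
        _ ≤ 2 := by rw [inv_le_comm₀ hr0 two_pos]; linarith
    have h3 : (1 - r ^ 2) ^ (-ε) * r ^ (1 - β) * (1 - (a * r) ^ 2)⁻¹ ≤
        (1 - r) ^ (-ε) * 2 * (max (1 - r) ((1 - a ^ 2) / 2))⁻¹ := by
      gcongr
    rw [div_eq_mul_inv]
    linarith

theorem lintegral_Ioo_comp_one_sub_le (f : ℝ → ℝ≥0∞) :
    ∫⁻ r in Ioo 0 1, f (1 - r) ≤ ∫⁻ s in Ioi 0, f s := by
  rw [← lintegral_indicator measurableSet_Ioi, ← lintegral_indicator measurableSet_Ioo,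
    ← lintegral_sub_left_eq_self ((Ioi 0).indicator f) 1]
  refine lintegral_mono fun r ↦ ?_
  by_cases hr : r ∈ Ioo (0 : ℝ) 1
  · rw [indicator_of_mem hr, indicator_of_mem (show 1 - r ∈ Ioi (0 : ℝ) from sub_pos.mpr hr.2)]
  · simp [hr]

theorem lintegral_radial_le {ε β a : ℝ} (hε : ε ∈ Ioo (0 : ℝ) 1) (hβ : β ∈ Ico (0 : ℝ) 2)
    (ha : a ∈ Ico (0 : ℝ) 1) :
    ∫⁻ r in Ioo 0 1,
        ENNReal.ofReal (r * ((1 - r ^ 2) ^ (-ε) * r ^ (-β)) * (1 - (a * r) ^ 2)⁻¹) ≤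
      ENNReal.ofReal
        ((4 / (2 - β) + 2 * (1 / (1 - ε) + 1 / ε)) * ((1 - a ^ 2) / 2) ^ (-ε)) := by
  have hδ : 0 < (1 - a ^ 2) / 2 := by nlinarith [ha.1, ha.2]
  have hβ' : 0 < 2 - β := sub_pos.mpr hβ.2
  have hε' : 0 < 1 - ε := sub_pos.mpr hε.2
  have hε0 := hε.1
  calc _ ≤ ∫⁻ r in Ioo 0 1, (ENNReal.ofReal 4 * ENNReal.ofReal (r ^ (1 - β)) +
          ENNReal.ofReal 2 * ENNReal.ofReal ((1 - r) ^ (-ε) / max (1 - r) ((1 - a ^ 2) / 2))) := by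
        refine setLIntegral_mono' measurableSet_Ioo fun r hr ↦ ?_
        have h1r : 0 < 1 - r := sub_pos.mpr hr.2
        have hr0 := hr.1
        have hm : 0 < max (1 - r) ((1 - a ^ 2) / 2) := lt_max_of_lt_left h1r
        rw [← ENNReal.ofReal_mul (by norm_num), ← ENNReal.ofReal_mul (by norm_num),
          ← ENNReal.ofReal_add (by positivity) (by positivity)]
        exact ENNReal.ofReal_le_ofReal (radial_weight_le hε hβ ha hr)
    _ = ENNReal.ofReal 4 * (∫⁻ r in Ioo 0 1, ENNReal.ofReal (r ^ (1 - β))) +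
          ENNReal.ofReal 2 * ∫⁻ r in Ioo 0 1,
            ENNReal.ofReal ((1 - r) ^ (-ε) / max (1 - r) ((1 - a ^ 2) / 2)) := by
        rw [lintegral_add_left (by fun_prop), lintegral_const_mul' _ _ ENNReal.ofReal_ne_top,
          lintegral_const_mul' _ _ ENNReal.ofReal_ne_top]
    _ ≤ ENNReal.ofReal 4 * ENNReal.ofReal (1 / (2 - β)) + ENNReal.ofReal 2 *
          ENNReal.ofReal ((1 / (1 - ε) + 1 / ε) * ((1 - a ^ 2) / 2) ^ (-ε)) := by
        gcongr
        · rw [lintegral_Ioo_zero_rpow (by linarith) zero_le_one, Real.one_rpow]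
          exact le_of_eq (by ring_nf)
        · exact (lintegral_Ioo_comp_one_sub_le
            fun s ↦ ENNReal.ofReal (s ^ (-ε) / max s ((1 - a ^ 2) / 2))).trans
              (lintegral_rpow_div_max_le hε hδ)
    _ ≤ _ := by
        rw [← ENNReal.ofReal_mul (by norm_num), ← ENNReal.ofReal_mul (by norm_num),
          ← ENNReal.ofReal_add (by positivity) (by positivity)]
        refine ENNReal.ofReal_le_ofReal ?_
        have h1 : 1 ≤ ((1 - a ^ 2) / 2) ^ (-ε) :=
          Real.one_le_rpow_of_pos_of_le_one_of_nonpos hδ (by nlinarith) (by linarith)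
        have h2 : 4 / (2 - β) ≤ 4 / (2 - β) * ((1 - a ^ 2) / 2) ^ (-ε) :=
          le_mul_of_one_le_right (by positivity) h1
        have h3 : 4 * (1 / (2 - β)) = 4 / (2 - β) := by ring
        rw [h3]
        linarith

theorem Complex.lintegral_le_lintegral_polar (f : ℂ → ℝ≥0∞) :
    ∫⁻ w, f w ≤ ∫⁻ r in Ioi (0 : ℝ), ∫⁻ θ in Ioo (-Real.pi) Real.pi,
      ENNReal.ofReal r * f (r * Complex.exp (θ * Complex.I)) := by
  rw [← Complex.lintegral_comp_polarCoord_symm, polarCoord_target, Measure.volume_eq_prod,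
    ← Measure.prod_restrict]
  refine (lintegral_prod_le _).trans_eq ?_
  simp only [Complex.polarCoord_symm_apply, smul_eq_mul, Complex.exp_mul_I, Complex.ofReal_cos,
    Complex.ofReal_sin]

/-- For the unit disc `D ⊆ ℂ`, `ε ∈ (0,1)` and `β ∈ [0,2)`, the weighted Bergman-kernel
integral `∫_D (1-|w|²)^{-ε} |w|^{-β} / |1 - z conj w|² dV(w)` is bounded by a constant times
`(1-|z|²)^{-ε}`, uniformly in `z ∈ D`. -/
theorem disc_kernel_estimate (ε β : ℝ) (hε : ε ∈ Ioo (0:ℝ) 1) (hβ : β ∈ Ico (0:ℝ) 2) :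
    ∃ C : ℝ, ∀ z ∈ Metric.ball (0 : ℂ) 1,
      ∫⁻ w in Metric.ball (0 : ℂ) 1,
          ENNReal.ofReal ((1 - ‖w‖ ^ 2) ^ (-ε) * ‖w‖ ^ (-β) / ‖1 - z * conj w‖ ^ 2) ∂volume ≤
        ENNReal.ofReal (C * (1 - ‖z‖ ^ 2) ^ (-ε)) := by
  refine ⟨2 * Real.pi * ((4 / (2 - β) + 2 * (1 / (1 - ε) + 1 / ε)) * 2 ^ ε), fun z hz ↦ ?_⟩
  rw [mem_ball_zero_iff] at hz
  have hza : ‖z‖ ∈ Ico (0 : ℝ) 1 := ⟨norm_nonneg z, hz⟩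
  have hz2 : 0 ≤ 1 - ‖z‖ ^ 2 := by nlinarith [norm_nonneg z]
  rw [← lintegral_indicator Metric.isOpen_ball.measurableSet]
  refine (Complex.lintegral_le_lintegral_polar _).trans ?_
  calc _ ≤ ∫⁻ r in Ioi (0 : ℝ), (Ioo (0 : ℝ) 1).indicator (fun r ↦ ENNReal.ofReal (2 * Real.pi) *
          ENNReal.ofReal (r * ((1 - r ^ 2) ^ (-ε) * r ^ (-β)) * (1 - (‖z‖ * r) ^ 2)⁻¹)) r := by
        refine setLIntegral_mono' measurableSet_Ioi fun r hr ↦ ?_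
        rw [mem_Ioi] at hr
        have hnorm : ∀ θ : ℝ, ‖(r : ℂ) * Complex.exp (θ * Complex.I)‖ = r := fun θ ↦ by
          rw [norm_mul, Complex.norm_exp_ofReal_mul_I, mul_one, Complex.norm_of_nonneg hr.le]
        by_cases hr1 : r < 1
        · rw [indicator_of_mem (show r ∈ Ioo (0 : ℝ) 1 from ⟨hr, hr1⟩)]
          have hcn : ‖conj z * r‖ = ‖z‖ * r := by
            rw [norm_mul, RCLike.norm_conj, Complex.norm_of_nonneg hr.le]
          have hc : ‖conj z * r‖ < 1 := by
            rw [hcn]; nlinarith [norm_nonneg z]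
          have hr2 : 0 ≤ 1 - r ^ 2 := by nlinarith
          have hg : 0 ≤ r * ((1 - r ^ 2) ^ (-ε) * r ^ (-β)) := by positivity
          have hker : ∀ θ : ℝ, ‖1 - z * conj ((r : ℂ) * Complex.exp (θ * Complex.I))‖ =
              ‖1 - conj z * r * Complex.exp (θ * Complex.I)‖ := fun θ ↦ by
            rw [← RCLike.norm_conj]
            simp [mul_assoc]
          refine le_of_eq ?_
          calc _ = ∫⁻ θ in Ioo (-Real.pi) Real.pi,
                ENNReal.ofReal (r * ((1 - r ^ 2) ^ (-ε) * r ^ (-β))) * ENNReal.ofReal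
                  (‖1 - conj z * r * Complex.exp (θ * Complex.I)‖ ^ 2)⁻¹ := by
                refine lintegral_congr fun θ ↦ ?_
                rw [indicator_of_mem (by rwa [mem_ball_zero_iff, hnorm]), hnorm, hker,
                  ← ENNReal.ofReal_mul hr.le, ← ENNReal.ofReal_mul hg, div_eq_mul_inv, mul_assoc r]
            _ = _ := by
                rw [lintegral_const_mul' _ _ ENNReal.ofReal_ne_top,
                  lintegral_inv_norm_one_sub_mul_exp_sq hc, hcn, ← ENNReal.ofReal_mul hg,
                  ← ENNReal.ofReal_mul (by positivity)]
                congr 1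
                ring
        · refine le_of_eq_of_le ?_ zero_le
          refine (lintegral_congr fun θ ↦ ?_).trans lintegral_zero
          rw [indicator_of_notMem (by rwa [mem_ball_zero_iff, hnorm]), mul_zero]
    _ ≤ ∫⁻ r in Ioo (0 : ℝ) 1, ENNReal.ofReal (2 * Real.pi) *
          ENNReal.ofReal (r * ((1 - r ^ 2) ^ (-ε) * r ^ (-β)) * (1 - (‖z‖ * r) ^ 2)⁻¹) := by
        rw [← lintegral_indicator (s := Ioo (0 : ℝ) 1) measurableSet_Ioo]
        exact setLIntegral_le_lintegral _ _
    _ ≤ ENNReal.ofReal (2 * Real.pi) * ENNReal.ofReal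
          ((4 / (2 - β) + 2 * (1 / (1 - ε) + 1 / ε)) * ((1 - ‖z‖ ^ 2) / 2) ^ (-ε)) := by
        rw [lintegral_const_mul' _ _ ENNReal.ofReal_ne_top]
        gcongr
        exact lintegral_radial_le hε hβ hza
    _ = _ := by
        rw [← ENNReal.ofReal_mul (by positivity), Real.div_rpow hz2 zero_le_two,
          Real.rpow_neg zero_le_two, div_inv_eq_mul]
        congr 1
        ring
end
end

section
/- Let k ≥ 1 be an integer, ε ∈ (0,1), and fix z = (z₁,z₂) ∈ Ω_k = {(z₁,z₂) ∈ ℂ² : |z₁|^k < |z₂| < 1} and w₂ ∈ ℂ with 0 < |w₂| < 1. Then there is a constant C = C(k,ε) independent of z and w₂ such that ∫_{|w₁| < |w₂|^{1/k}} (|w₂|² − |w₁|^{2k})^{−ε} |z₂·conj(w₂) − z₁^k·conj(w₁)^k|^{−2} dV(w₁) ≤ C |w₂|^{2/k − 2 − 2ε} |z₂|^{2ε − 2} (|z₂|² − |z₁|^{2k})^{−ε}. -/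
open MeasureTheory Set NNReal ENNReal ComplexConjugate

noncomputable section

/-- The fat Hartogs triangle of exponent `k`. -/
def fatHartogs (k : ℕ) : Set (ℂ × ℂ) := {z | ‖z.1‖ ^ k < ‖z.2‖ ∧ ‖z.2‖ < 1}

/-- The Poisson kernel as the real part of a holomorphic function. -/
lemma one_div_norm_sub_sq_eq_re {a u : ℂ} (h : ‖u‖ < ‖a‖) :
    1 / ‖a - u‖ ^ 2 = (‖a‖ ^ 2 - ‖u‖ ^ 2)⁻¹ * ((a + u) / (a - u)).re := by
  have hau : a - u ≠ 0 := sub_ne_zero.2 fun h' => by simp [h'] at h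
  have hn : Complex.normSq (a - u) ≠ 0 := by simpa using hau
  have hd : ‖a‖ ^ 2 - ‖u‖ ^ 2 ≠ 0 :=
    (sub_pos.2 (pow_lt_pow_left₀ h (norm_nonneg _) two_ne_zero)).ne'
  have hre : ((a + u) / (a - u)).re = (‖a‖ ^ 2 - ‖u‖ ^ 2) / Complex.normSq (a - u) := by
    rw [Complex.div_re, Complex.sq_norm, Complex.sq_norm, ← add_div]
    congr 1
    simp only [Complex.normSq_apply, Complex.add_re, Complex.add_im, Complex.sub_re,
      Complex.sub_im]
    ring
  rw [hre, Complex.sq_norm (a - u)]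
  field_simp

/-- The angular integral of `|a - b e^{ikθ}|⁻²`, computed by the mean value property. -/
lemma lintegral_one_div_norm_sub_sq {a b : ℂ} (h : ‖b‖ < ‖a‖) {k : ℕ} (hk : k ≠ 0) :
    ∫⁻ θ in Ioo (-Real.pi) Real.pi,
        ENNReal.ofReal (1 / ‖a - b * circleMap 0 1 θ ^ k‖ ^ 2) =
      ENNReal.ofReal (2 * Real.pi / (‖a‖ ^ 2 - ‖b‖ ^ 2)) := by
  have ha : a ≠ 0 := norm_pos_iff.1 ((norm_nonneg b).trans_lt h)
  have hne : ∀ w : ℂ, ‖w‖ ≤ 1 → a - b * w ^ k ≠ 0 := fun w hw => by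
    refine sub_ne_zero.2 fun h' => h.not_ge ?_
    rw [h', norm_mul, norm_pow]
    exact mul_le_of_le_one_right (norm_nonneg _) (pow_le_one₀ (norm_nonneg _) hw)
  set f : ℂ → ℂ := fun w => (a + b * w ^ k) / (a - b * w ^ k) with hf
  have hcont : Continuous fun θ : ℝ => f (circleMap 0 1 θ) :=
    Continuous.div (by fun_prop) (by fun_prop) fun θ => hne _ (by simp)
  have hmean : ∫ θ in (-Real.pi)..Real.pi, f (circleMap 0 1 θ) = 2 * Real.pi := by
    have h1 : Real.circleAverage f 0 1 = f 0 := by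
      refine circleAverage_of_differentiable_on_off_countable countable_empty ?_ ?_
      · refine ContinuousOn.div (by fun_prop) (by fun_prop) fun w hw => hne w (by simpa using hw)
      · refine fun w hw => DifferentiableAt.div (by fun_prop) (by fun_prop) (hne w ?_)
        simpa using (mem_ball_zero_iff.1 hw.1).le
    rw [Real.circleAverage_eq_integral_add (-Real.pi),
      intervalIntegral.integral_comp_add_right (fun θ => f (circleMap 0 1 θ))] at h1
    have hf0 : f 0 = 1 := by simp [hf, hk, ha]
    rw [hf0, inv_smul_eq_iff₀ (by positivity)] at h1
    convert h1 using 2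
    · ring
    · ring
    · simp
  have hpt : ∀ θ : ℝ, 1 / ‖a - b * circleMap 0 1 θ ^ k‖ ^ 2 =
      (‖a‖ ^ 2 - ‖b‖ ^ 2)⁻¹ * (f (circleMap 0 1 θ)).re := fun θ => by
    have := one_div_norm_sub_sq_eq_re (a := a) (u := b * circleMap 0 1 θ ^ k) (by simpa using h)
    simpa using this
  have hint : IntervalIntegrable (fun θ => f (circleMap 0 1 θ)) volume (-Real.pi) Real.pi :=
    hcont.intervalIntegrable _ _
  have hpi : -Real.pi ≤ Real.pi := by linarith [Real.pi_pos]
  have hval : ∫ θ in (-Real.pi)..Real.pi, 1 / ‖a - b * circleMap 0 1 θ ^ k‖ ^ 2 =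
      2 * Real.pi / (‖a‖ ^ 2 - ‖b‖ ^ 2) := by
    simp_rw [hpt]
    have hre := Complex.reCLM.intervalIntegral_comp_comm hint
    simp only [Complex.reCLM_apply] at hre
    rw [intervalIntegral.integral_const_mul, hre, hmean]
    simp
    ring
  have hint' : IntervalIntegrable (fun θ => 1 / ‖a - b * circleMap 0 1 θ ^ k‖ ^ 2) volume
      (-Real.pi) Real.pi := by
    simp_rw [hpt]
    exact (continuous_const.mul (Complex.continuous_re.comp hcont)).intervalIntegrable _ _
  rw [intervalIntegrable_iff_integrableOn_Ioo_of_le hpi] at hint'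
  rw [← ofReal_integral_eq_lintegral_ofReal hint' (ae_of_all _ fun θ => by positivity),
    ← integral_Ioc_eq_integral_Ioo, ← intervalIntegral.integral_of_le hpi, hval]

lemma lintegral_rpow_mul_min_le {ε δ : ℝ} (hε₀ : 0 < ε) (hε₁ : ε < 1) (hδ : 0 < δ) :
    ∫⁻ s in Ioi (0 : ℝ), ENNReal.ofReal (s ^ (-ε) * min (1 / δ) (1 / s)) ≤
      ENNReal.ofReal (δ ^ (-ε) * (1 / (1 - ε) + 1 / ε)) := by
  have hnear : ∫⁻ s in Ioc (0 : ℝ) δ, ENNReal.ofReal (s ^ (-ε) * min (1 / δ) (1 / s)) ≤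
      ENNReal.ofReal (δ ^ (-ε) * (1 / (1 - ε))) := by
    calc _ ≤ ∫⁻ s in Ioc (0 : ℝ) δ, ENNReal.ofReal (s ^ (-ε) * (1 / δ)) := by
          refine setLIntegral_mono' measurableSet_Ioc fun s hs => ENNReal.ofReal_le_ofReal ?_
          have := hs.1
          gcongr
          exact min_le_left _ _
      _ = ENNReal.ofReal (δ ^ (-ε) * (1 / (1 - ε))) := by
          have hi : IntervalIntegrable (fun s : ℝ => s ^ (-ε) * (1 / δ)) volume 0 δ :=
            (intervalIntegral.intervalIntegrable_rpow' (by linarith)).mul_const _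
          rw [intervalIntegrable_iff_integrableOn_Ioc_of_le hδ.le] at hi
          rw [← ofReal_integral_eq_lintegral_ofReal hi
            ((ae_restrict_mem measurableSet_Ioc).mono fun s hs => by
              have := hs.1
              positivity), ← intervalIntegral.integral_of_le hδ.le,
            intervalIntegral.integral_mul_const, integral_rpow (Or.inl (by linarith)),
            Real.zero_rpow (by linarith), Real.rpow_add_one hδ.ne']
          congr 1
          have : 1 - ε ≠ 0 := by linarith
          have : -ε + 1 ≠ 0 := by linarith
          field_simp
          ring
  have hfar : ∫⁻ s in Ioi δ, ENNReal.ofReal (s ^ (-ε) * min (1 / δ) (1 / s)) ≤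
      ENNReal.ofReal (δ ^ (-ε) * (1 / ε)) := by
    calc _ ≤ ∫⁻ s in Ioi δ, ENNReal.ofReal (s ^ (-ε - 1)) := by
          refine setLIntegral_mono' measurableSet_Ioi fun s hs => ENNReal.ofReal_le_ofReal ?_
          have hs₀ : 0 < s := hδ.trans hs
          rw [Real.rpow_sub_one hs₀.ne', div_eq_mul_one_div (s ^ (-ε))]
          gcongr
          exact min_le_right _ _
      _ = ENNReal.ofReal (δ ^ (-ε) * (1 / ε)) := by
          rw [← ofReal_integral_eq_lintegral_ofReal
            (integrableOn_Ioi_rpow_of_lt (by linarith) hδ)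
            ((ae_restrict_mem measurableSet_Ioi).mono fun s hs => by
              have : 0 < s := hδ.trans hs
              positivity), integral_Ioi_rpow_of_lt (by linarith) hδ]
          congr 1
          rw [sub_add_cancel]
          field_simp
  rw [← Ioc_union_Ioi_eq_Ioi hδ.le, mul_add,
    ENNReal.ofReal_add (by have : 0 < 1 - ε := by linarith
                           positivity) (by positivity)]
  exact (lintegral_union_le _ _ _).trans (add_le_add hnear hfar)

/-- Pointwise bound for the radial density in terms of the distance `R - r` to the boundary. -/
lemma radial_density_le {k : ℕ} (hk : 1 ≤ k) {ε r R P Z : ℝ} (hε : 0 < ε) (hr : 0 < r)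
    (hrR : r < R) (hP : 0 ≤ P) (hPZ : P ^ k < Z) :
    r * ((R ^ k) ^ 2 - r ^ (2 * k)) ^ (-ε) *
        (2 * Real.pi / ((Z * R ^ k) ^ 2 - (P ^ k * r ^ k) ^ 2)) ≤
      2 * Real.pi * R * (((R ^ k) ^ 2 / R) ^ (-ε) / ((Z * R ^ k) ^ 2 / R)) *
        ((R - r) ^ (-ε) * min (1 / (R * (1 - (P ^ k / Z) ^ 2))) (1 / (R - r))) := by
  have hR : 0 < R := hr.trans hrR
  have hs : 0 < R - r := sub_pos.2 hrR
  have hZ : 0 < Z := (pow_nonneg hP k).trans_lt hPZ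
  have hrk : r ^ k ≤ R ^ (k - 1) * r := by
    obtain ⟨m, rfl⟩ : ∃ m, k = m + 1 := ⟨k - 1, by omega⟩
    rw [pow_succ, Nat.add_sub_cancel]
    gcongr
  have hRk : R ^ k = R ^ (k - 1) * R := by
    rw [← pow_succ, Nat.sub_add_cancel hk]
  have hrk' : r ^ k ≤ R ^ k := by gcongr
  have hr2 : (r ^ k) ^ 2 ≤ (R ^ k) ^ 2 / R * r := by
    have : (R ^ k) ^ 2 / R * r = R ^ k * (R ^ (k - 1) * r) := by
      rw [sq, mul_div_assoc]
      nth_rewrite 2 [hRk]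
      field_simp
    rw [this, sq]
    gcongr
  have hdist : (R ^ k) ^ 2 / R * (R - r) ≤ (R ^ k) ^ 2 - (r ^ k) ^ 2 := by
    have : (R ^ k) ^ 2 / R * R = (R ^ k) ^ 2 := by field_simp
    rw [mul_sub, this]
    linarith
  have hq : (P ^ k / Z) ^ 2 < 1 := by
    have h0 : 0 ≤ P ^ k / Z := by positivity
    have h1 : P ^ k / Z < 1 := (div_lt_one hZ).2 hPZ
    exact pow_lt_one₀ h0 h1 two_ne_zero
  have hδ : 0 < 1 - (P ^ k / Z) ^ 2 := sub_pos.2 hq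
  have hD₁ : (Z * R ^ k) ^ 2 / R * (R * (1 - (P ^ k / Z) ^ 2)) ≤
      (Z * R ^ k) ^ 2 - (P ^ k * r ^ k) ^ 2 := by
    have h1 : (Z * R ^ k) ^ 2 / R * (R * (1 - (P ^ k / Z) ^ 2)) =
        (Z * R ^ k) ^ 2 - (P ^ k * R ^ k) ^ 2 := by
      field_simp
    rw [h1]
    gcongr
  have hD₂ : (Z * R ^ k) ^ 2 / R * (R - r) ≤ (Z * R ^ k) ^ 2 - (P ^ k * r ^ k) ^ 2 := by
    have h1 : (P ^ k * r ^ k) ^ 2 ≤ (Z * r ^ k) ^ 2 := by gcongr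
    have h2 := mul_le_mul_of_nonneg_left hdist (sq_nonneg Z)
    have h3 : (Z * R ^ k) ^ 2 / R * (R - r) = Z ^ 2 * ((R ^ k) ^ 2 / R * (R - r)) := by ring
    rw [h3]
    nlinarith
  have hE : 2 * Real.pi / ((Z * R ^ k) ^ 2 - (P ^ k * r ^ k) ^ 2) ≤
      2 * Real.pi / ((Z * R ^ k) ^ 2 / R) *
        min (1 / (R * (1 - (P ^ k / Z) ^ 2))) (1 / (R - r)) := by
    rw [mul_min_of_nonneg _ _ (by positivity)]
    refine le_min ?_ ?_
    · rw [div_mul_div_comm, mul_one]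
      gcongr
    · rw [div_mul_div_comm, mul_one]
      gcongr
  have hF : ((R ^ k) ^ 2 - r ^ (2 * k)) ^ (-ε) ≤ ((R ^ k) ^ 2 / R) ^ (-ε) * (R - r) ^ (-ε) := by
    rw [← Real.mul_rpow (by positivity) hs.le, mul_comm 2 k, pow_mul]
    exact Real.rpow_le_rpow_of_nonpos (by positivity) hdist (by linarith)
  have hE0 : 0 ≤ 2 * Real.pi / ((Z * R ^ k) ^ 2 - (P ^ k * r ^ k) ^ 2) := by
    refine div_nonneg (by positivity) (le_trans ?_ hD₂)
    positivity
  have hF0 : 0 ≤ ((R ^ k) ^ 2 - r ^ (2 * k)) ^ (-ε) := by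
    refine Real.rpow_nonneg ?_ _
    rw [mul_comm 2 k, pow_mul]
    exact sub_nonneg.2 (by gcongr)
  calc _ ≤ R * (((R ^ k) ^ 2 / R) ^ (-ε) * (R - r) ^ (-ε)) *
        (2 * Real.pi / ((Z * R ^ k) ^ 2 / R) *
        min (1 / (R * (1 - (P ^ k / Z) ^ 2))) (1 / (R - r))) := by
        gcongr
    _ = _ := by ring

/-- The scaling factors of the radial integral collapse to the powers in the final estimate. -/
lemma radial_constant_eq {k : ℕ} {ε W P Z c : ℝ} (hW : 0 < W) (hP : 0 ≤ P)
    (hPZ : P ^ k < Z) {R : ℝ} (hR : R = W ^ ((1 : ℝ) / k)) :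
    2 * Real.pi * R * ((W ^ 2 / R) ^ (-ε) / ((Z * W) ^ 2 / R)) *
        ((R * (1 - (P ^ k / Z) ^ 2)) ^ (-ε) * c) =
      2 * Real.pi * c * W ^ (2 / (k : ℝ) - 2 - 2 * ε) * Z ^ (2 * ε - 2) *
        (Z ^ 2 - P ^ (2 * k)) ^ (-ε) := by
  have hR₀ : 0 < R := hR ▸ Real.rpow_pos_of_pos hW _
  have hZ : 0 < Z := (pow_nonneg hP k).trans_lt hPZ
  have hA : 0 < Z ^ 2 - P ^ (2 * k) := by
    rw [mul_comm, pow_mul]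
    exact sub_pos.2 (pow_lt_pow_left₀ hPZ (by positivity) two_ne_zero)
  have hδ : R * (1 - (P ^ k / Z) ^ 2) = R * (Z ^ 2 - P ^ (2 * k)) / Z ^ 2 := by
    rw [mul_comm 2 k, pow_mul]
    field_simp
  have hW2 : W ^ (2 / (k : ℝ) - 2 - 2 * ε) = R ^ 2 / W ^ 2 * (W ^ 2) ^ (-ε) := by
    rw [hR, ← Real.rpow_natCast (W ^ _) 2, ← Real.rpow_natCast W 2, ← Real.rpow_mul hW.le,
      ← Real.rpow_mul hW.le, ← Real.rpow_sub hW, ← Real.rpow_add hW]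
    congr 1
    push_cast
    ring
  have hZ2 : Z ^ (2 * ε - 2) = ((Z ^ 2) ^ (-ε))⁻¹ / Z ^ 2 := by
    rw [← Real.rpow_natCast Z 2, ← Real.rpow_mul hZ.le, ← Real.rpow_neg hZ.le,
      ← Real.rpow_sub hZ]
    congr 1
    push_cast
    ring
  rw [hδ, hW2, hZ2, Real.div_rpow (by positivity) (by positivity),
    Real.div_rpow (by positivity) (by positivity), Real.mul_rpow (by positivity) hA.le]
  have h1 : R ^ (-ε) ≠ 0 := (Real.rpow_pos_of_pos hR₀ _).ne'
  have h2 : (Z ^ 2) ^ (-ε) ≠ 0 := (Real.rpow_pos_of_pos (by positivity) _).ne'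
  field_simp

/-- The inner `w₁`-integral estimate: for `k ≥ 1`, `ε ∈ (0,1)`, there is `C = C(k,ε)` such
that for every `z ∈ Ω_k` and every `w₂` with `0 < |w₂| < 1`,
`∫_{|w₁| < |w₂|^{1/k}} (|w₂|² - |w₁|^{2k})^{-ε} |z₂ conj w₂ - z₁^k conj w₁^k|^{-2} dV(w₁)
  ≤ C |w₂|^{2/k - 2 - 2ε} |z₂|^{2ε-2} (|z₂|² - |z₁|^{2k})^{-ε}`. -/
theorem hartogs_inner_integral_estimate (k : ℕ) (hk : 1 ≤ k) (ε : ℝ) (hε : ε ∈ Ioo (0:ℝ) 1) :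
    ∃ C : ℝ, ∀ z ∈ fatHartogs k, ∀ w₂ : ℂ, 0 < ‖w₂‖ → ‖w₂‖ < 1 →
      ∫⁻ w₁ in {w₁ : ℂ | ‖w₁‖ < ‖w₂‖ ^ ((1 : ℝ) / k)},
          ENNReal.ofReal ((‖w₂‖ ^ 2 - ‖w₁‖ ^ (2 * k)) ^ (-ε) /
            ‖z.2 * conj w₂ - z.1 ^ k * (conj w₁) ^ k‖ ^ 2) ∂volume ≤
        ENNReal.ofReal (C * ‖w₂‖ ^ (2 / (k : ℝ) - 2 - 2 * ε) * ‖z.2‖ ^ (2 * ε - 2) *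
          (‖z.2‖ ^ 2 - ‖z.1‖ ^ (2 * k)) ^ (-ε)) := by
  obtain ⟨hε₀, hε₁⟩ := hε
  refine ⟨2 * Real.pi * (1 / (1 - ε) + 1 / ε), fun z hz w₂ hw₀ _ => ?_⟩
  have hPZ : ‖z.1‖ ^ k < ‖z.2‖ := hz.1
  set R : ℝ := ‖w₂‖ ^ ((1 : ℝ) / k) with hR
  have hk₀ : k ≠ 0 := by omega
  have hR₀ : 0 < R := Real.rpow_pos_of_pos hw₀ _
  have hRk : R ^ k = ‖w₂‖ := by
    rw [hR, one_div, Real.rpow_inv_natCast_pow hw₀.le hk₀]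
  have hZ : 0 < ‖z.2‖ := (pow_nonneg (norm_nonneg _) k).trans_lt hPZ
  have hq : 0 < 1 - (‖z.1‖ ^ k / ‖z.2‖) ^ 2 :=
    sub_pos.2 (pow_lt_one₀ (by positivity) ((div_lt_one hZ).2 hPZ) two_ne_zero)
  set K : ℝ := 2 * Real.pi * R * ((‖w₂‖ ^ 2 / R) ^ (-ε) / ((‖z.2‖ * ‖w₂‖) ^ 2 / R)) with hK
  have hK₀ : 0 ≤ K := by positivity
  set φ : ℝ → ℝ≥0∞ := (Ioi (0 : ℝ)).indicator fun s => ENNReal.ofReal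
    (s ^ (-ε) * min (1 / (R * (1 - (‖z.1‖ ^ k / ‖z.2‖) ^ 2))) (1 / s)) with hφ
  set f : ℂ → ℝ≥0∞ := fun w₁ => ENNReal.ofReal ((‖w₂‖ ^ 2 - ‖w₁‖ ^ (2 * k)) ^ (-ε) /
    ‖z.2 * conj w₂ - z.1 ^ k * (conj w₁) ^ k‖ ^ 2) with hf
  have hradial : ∀ r ∈ Ioi (0 : ℝ), ∫⁻ θ in Ioo (-Real.pi) Real.pi, ENNReal.ofReal r *
      {w₁ : ℂ | ‖w₁‖ < R}.indicator f (r * circleMap 0 1 θ) ≤ ENNReal.ofReal K * φ (R - r) := by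
    intro r (hr : 0 < r)
    by_cases hrR : r < R
    · have hfr : ∀ θ : ℝ, ENNReal.ofReal r *
          {w₁ : ℂ | ‖w₁‖ < R}.indicator f (r * circleMap 0 1 θ) =
          ENNReal.ofReal (r * (‖w₂‖ ^ 2 - r ^ (2 * k)) ^ (-ε)) *
          ENNReal.ofReal (1 / ‖conj z.2 * w₂ -
            (conj z.1 ^ k * (r : ℂ) ^ k) * circleMap 0 1 θ ^ k‖ ^ 2) := by
        intro θ
        have hn : ‖(r : ℂ) * circleMap 0 1 θ‖ = r := by simp [hr.le]
        have hpos : 0 ≤ ‖w₂‖ ^ 2 - r ^ (2 * k) := by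
          rw [← hRk, mul_comm 2 k, pow_mul]
          exact sub_nonneg.2 (by gcongr)
        have hconj : ‖z.2 * conj w₂ - z.1 ^ k * conj ((r : ℂ) * circleMap 0 1 θ) ^ k‖ =
            ‖conj z.2 * w₂ - (conj z.1 ^ k * (r : ℂ) ^ k) * circleMap 0 1 θ ^ k‖ := by
          rw [← RCLike.norm_conj]
          simp [mul_pow, mul_assoc]
        have hmem : (r : ℂ) * circleMap 0 1 θ ∈ {w₁ : ℂ | ‖w₁‖ < R} := hn.trans_lt hrR
        rw [indicator_of_mem hmem]
        simp only [hf]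
        rw [hn, hconj, ← ENNReal.ofReal_mul hr.le, ← ENNReal.ofReal_mul (by positivity)]
        congr 1
        ring
      have hlt : ‖conj z.1 ^ k * (r : ℂ) ^ k‖ < ‖conj z.2 * w₂‖ := by
        simp only [norm_mul, norm_pow, RCLike.norm_conj, Complex.norm_real, Real.norm_eq_abs,
          abs_of_pos hr]
        rw [← hRk]
        exact mul_lt_mul hPZ (by gcongr) (by positivity) hZ.le
      simp_rw [hfr]
      rw [lintegral_const_mul' _ _ ENNReal.ofReal_ne_top, lintegral_one_div_norm_sub_sq hlt hk₀,
        hφ, indicator_of_mem (mem_Ioi.2 (sub_pos.2 hrR)), ← ENNReal.ofReal_mul hK₀,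
        ← ENNReal.ofReal_mul' (div_nonneg (by positivity)
          (sub_nonneg.2 (pow_le_pow_left₀ (norm_nonneg _) hlt.le 2)))]
      refine ENNReal.ofReal_le_ofReal ?_
      have := radial_density_le hk hε₀ hr hrR (norm_nonneg z.1) hPZ
      simpa [hRk, abs_of_pos hr, hK] using this
    · have h0 : ∀ θ : ℝ, {w₁ : ℂ | ‖w₁‖ < R}.indicator f (r * circleMap 0 1 θ) = 0 := fun θ =>
        indicator_of_notMem (by simpa [abs_of_pos hr] using hrR) _
      simp [h0]
  calc ∫⁻ w₁ in {w₁ : ℂ | ‖w₁‖ < R}, f w₁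
      = ∫⁻ w₁, {w₁ : ℂ | ‖w₁‖ < R}.indicator f w₁ :=
        (lintegral_indicator (measurableSet_lt measurable_norm measurable_const) f).symm
    _ = ∫⁻ p in Ioi (0 : ℝ) ×ˢ Ioo (-Real.pi) Real.pi, ENNReal.ofReal p.1 *
          {w₁ : ℂ | ‖w₁‖ < R}.indicator f (p.1 * circleMap 0 1 p.2) := by
        rw [← Complex.lintegral_comp_polarCoord_symm, polarCoord_target]
        simp [Complex.polarCoord_symm_apply, circleMap, Complex.exp_mul_I]
    _ ≤ ∫⁻ r in Ioi (0 : ℝ), ∫⁻ θ in Ioo (-Real.pi) Real.pi, ENNReal.ofReal r *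
          {w₁ : ℂ | ‖w₁‖ < R}.indicator f (r * circleMap 0 1 θ) := by
        rw [Measure.volume_eq_prod, ← Measure.prod_restrict]
        exact lintegral_prod_le _
    _ ≤ ∫⁻ r in Ioi (0 : ℝ), ENNReal.ofReal K * φ (R - r) :=
        setLIntegral_mono' measurableSet_Ioi hradial
    _ ≤ ∫⁻ r, ENNReal.ofReal K * φ (R - r) := setLIntegral_le_lintegral _ _
    _ = ENNReal.ofReal K * ∫⁻ s, φ s := by
        rw [lintegral_const_mul' _ _ ENNReal.ofReal_ne_top, lintegral_sub_left_eq_self φ R]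
    _ ≤ ENNReal.ofReal K * ENNReal.ofReal
          ((R * (1 - (‖z.1‖ ^ k / ‖z.2‖) ^ 2)) ^ (-ε) * (1 / (1 - ε) + 1 / ε)) := by
        gcongr
        rw [hφ, lintegral_indicator measurableSet_Ioi]
        exact lintegral_rpow_mul_min_le hε₀ hε₁ (by positivity)
    _ = _ := by
        rw [← ENNReal.ofReal_mul hK₀, hK, radial_constant_eq hw₀ (norm_nonneg _) hPZ hR]
end
end

section
/- Let k ≥ 1 be an integer, and define the polynomials p_k(s) = Σ_{n=1}^{k−1} n(k−n) s^{n−1} and q_k(s) = Σ_{n=1}^{k} (n² + (k−n)² s^k) s^{n−1}. Then there is a constant C = C(k) such that for all s, t ∈ ℂ with |s|^k < |t| < 1, |p_k(s) t² + q_k(s) t + s^k p_k(s)| ≤ C |t|. Consequently the Bergman kernel 𝔹_k(z,w) = (p_k(s)t² + q_k(s)t + s^k p_k(s)) / (kπ²(1−t)²(t−s^k)²) of Ω_k, with s = z₁·conj(w₁) and t = z₂·conj(w₂), satisfies |𝔹_k(z,w)| ≤ C' |t| / (|1−t|² |t−s^k|²) on Ω_k × Ω_k. -/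
open MeasureTheory Set NNReal ENNReal ComplexConjugate Finset

noncomputable section

/-- `p_k(s) = Σ_{n=1}^{k-1} n (k-n) s^{n-1}`. -/
def pPoly (k : ℕ) (s : ℂ) : ℂ :=
  ∑ n ∈ Finset.Icc 1 (k - 1), (n : ℂ) * ((k : ℂ) - (n : ℂ)) * s ^ (n - 1)

/-- `q_k(s) = Σ_{n=1}^{k} (n² + (k-n)² s^k) s^{n-1}`. -/
def qPoly (k : ℕ) (s : ℂ) : ℂ :=
  ∑ n ∈ Finset.Icc 1 k, ((n : ℂ) ^ 2 + ((k : ℂ) - (n : ℂ)) ^ 2 * s ^ k) * s ^ (n - 1)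

/-- The Bergman kernel of the fat Hartogs triangle `Ω_k`, written in the variables
`s = z₁ conj w₁`, `t = z₂ conj w₂`. -/
def bergKernel (k : ℕ) (z w : ℂ × ℂ) : ℂ :=
  (pPoly k (z.1 * conj w.1) * (z.2 * conj w.2) ^ 2 + qPoly k (z.1 * conj w.1) * (z.2 * conj w.2)
      + (z.1 * conj w.1) ^ k * pPoly k (z.1 * conj w.1)) /
    ((k : ℂ) * (Real.pi : ℂ) ^ 2 * (1 - z.2 * conj w.2) ^ 2
      * (z.2 * conj w.2 - (z.1 * conj w.1) ^ k) ^ 2)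

lemma exists_norm_le_of_continuous_of_norm_le_one {f : ℂ → ℂ} (hf : Continuous f) :
    ∃ M : ℝ, ∀ s : ℂ, ‖s‖ ≤ 1 → ‖f s‖ ≤ M := by
  obtain ⟨M, hM⟩ := (isCompact_closedBall (0 : ℂ) 1).exists_bound_of_continuousOn hf.continuousOn
  exact ⟨M, fun s hs => hM s (by simpa using hs)⟩

lemma continuous_pPoly (k : ℕ) : Continuous (pPoly k) := by
  unfold pPoly
  fun_prop

lemma continuous_qPoly (k : ℕ) : Continuous (qPoly k) := by
  unfold qPoly
  fun_prop

lemma exists_norm_numerator_le (k : ℕ) (hk : 1 ≤ k) :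
    ∃ C : ℝ, ∀ s t : ℂ, ‖s‖ ^ k < ‖t‖ → ‖t‖ < 1 →
      ‖pPoly k s * t ^ 2 + qPoly k s * t + s ^ k * pPoly k s‖ ≤ C * ‖t‖ := by
  obtain ⟨P, hP⟩ := exists_norm_le_of_continuous_of_norm_le_one (continuous_pPoly k)
  obtain ⟨Q, hQ⟩ := exists_norm_le_of_continuous_of_norm_le_one (continuous_qPoly k)
  refine ⟨P + Q + P, fun s t hst ht => ?_⟩
  have hs : ‖s‖ ≤ 1 :=
    ((pow_lt_one_iff_of_nonneg (norm_nonneg s) (by omega)).1 (hst.trans ht)).le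
  have hp := hP s hs
  have hq := hQ s hs
  have hP0 : 0 ≤ P := (norm_nonneg _).trans hp
  have ht2 : ‖t‖ ^ 2 ≤ ‖t‖ := pow_le_of_le_one (norm_nonneg t) ht.le two_ne_zero
  calc ‖pPoly k s * t ^ 2 + qPoly k s * t + s ^ k * pPoly k s‖
      ≤ ‖pPoly k s‖ * ‖t‖ ^ 2 + ‖qPoly k s‖ * ‖t‖ + ‖s‖ ^ k * ‖pPoly k s‖ := by
        rw [← norm_pow t, ← norm_pow s, ← norm_mul, ← norm_mul, ← norm_mul]
        exact norm_add₃_le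
    _ ≤ P * ‖t‖ + Q * ‖t‖ + ‖t‖ * P := by gcongr
    _ = (P + Q + P) * ‖t‖ := by ring

lemma norm_mul_conj_pow_lt {k : ℕ} {z w : ℂ × ℂ} (hz : z ∈ fatHartogs k)
    (hw : w ∈ fatHartogs k) : ‖z.1 * conj w.1‖ ^ k < ‖z.2 * conj w.2‖ := by
  rw [norm_mul, norm_mul, RCLike.norm_conj, RCLike.norm_conj, mul_pow]
  exact mul_lt_mul'' hz.1 hw.1 (by positivity) (by positivity)

lemma norm_mul_conj_lt_one {k : ℕ} {z w : ℂ × ℂ} (hz : z ∈ fatHartogs k)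
    (hw : w ∈ fatHartogs k) : ‖z.2 * conj w.2‖ < 1 := by
  rw [norm_mul, RCLike.norm_conj]
  exact mul_lt_one_of_nonneg_of_lt_one_left (norm_nonneg _) hz.2 hw.2.le

/-- The numerator of the Bergman kernel of `Ω_k` is `O(|t|)` on `{|s|^k < |t| < 1}`, and
consequently `|𝔹_k(z,w)| ≲ |t| / (|1-t|²|t-s^k|²)` on `Ω_k × Ω_k`. -/
theorem bergman_kernel_numerator_bound (k : ℕ) (hk : 1 ≤ k) :
    (∃ C : ℝ, ∀ s t : ℂ, ‖s‖ ^ k < ‖t‖ → ‖t‖ < 1 →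
      ‖pPoly k s * t ^ 2 + qPoly k s * t + s ^ k * pPoly k s‖ ≤ C * ‖t‖) ∧
    (∃ C' : ℝ, ∀ z ∈ fatHartogs k, ∀ w ∈ fatHartogs k,
      ‖bergKernel k z w‖ ≤ C' * ‖z.2 * conj w.2‖ /
        (‖1 - z.2 * conj w.2‖ ^ 2 * ‖z.2 * conj w.2 - (z.1 * conj w.1) ^ k‖ ^ 2)) := by
  obtain ⟨C, hC⟩ := exists_norm_numerator_le k hk
  refine ⟨⟨C, hC⟩, C / (k * Real.pi ^ 2), fun z hz w hw => ?_⟩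
  have h := hC _ _ (norm_mul_conj_pow_lt hz hw) (norm_mul_conj_lt_one hz hw)
  have hden : ‖(k : ℂ) * (Real.pi : ℂ) ^ 2 * (1 - z.2 * conj w.2) ^ 2
      * (z.2 * conj w.2 - (z.1 * conj w.1) ^ k) ^ 2‖ = k * Real.pi ^ 2 *
      (‖1 - z.2 * conj w.2‖ ^ 2 * ‖z.2 * conj w.2 - (z.1 * conj w.1) ^ k‖ ^ 2) := by
    rw [norm_mul, norm_mul, norm_mul, norm_pow, norm_pow, norm_pow, Complex.norm_natCast,
      Complex.norm_real, Real.norm_of_nonneg Real.pi_pos.le, mul_assoc]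
  rw [bergKernel, norm_div, hden, div_mul_eq_mul_div, div_div]
  gcongr
end
end
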